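/- Let N, m ≥ 1 be integers and let S be the resampling matrix on ℝ^{Π(m)}. Define the matrix Š ∈ ℝ^{m×m} by Š_{i,j} = S(j,i) · N^{(i)} / N^j for 1 ≤ i ≤ j ≤ m and Š_{i,j} = 0 for i > j, where S(j,i) is the Stirling number of the second kind. Then for every f ∈ ℝ^{Π(m)} and every i ∈ {1,…,m}: Σ_{π ∈ Π(m), #π = i} (S f)_π = Σ_{j=1}^m Š_{i,j} · ( Σ_{π ∈ Π(m), #π = j} f_π ). In other words, the action of S on coefficient vectors induces the linear map Š on level-wise coefficient sums. -/

import Mathlib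

open Finset
open scoped Classical

/-- The resampling matrix `S ∈ ℝ^{Π(m)×Π(m)}`:
`S_{π,σ} = N^{(#π)} / N^{#σ}` if `σ ≤ π`, and `0` otherwise. -/
noncomputable def resampS (N m : ℕ) :
    Matrix (Finpartition (Finset.univ : Finset (Fin m)))
      (Finpartition (Finset.univ : Finset (Fin m))) ℝ :=
  fun π σ =>
    if σ ≤ π then (N.descFactorial π.parts.card : ℝ) / (N : ℝ) ^ σ.parts.card else 0

/-- The Stirling number of the second kind `S(j,i)`: the number of partitions of a
`j`-element set into exactly `i` nonempty parts. -/
noncomputable def stirlingSnd (j i : ℕ) : ℕ :=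
  Nat.card {τ : Finpartition (Finset.univ : Finset (Fin j)) // τ.parts.card = i}

/-- The reduced resampling matrix `Š`, with `Š_{i,j} = S(j,i)·N^{(i)}/N^j` for `i ≤ j`
and `Š_{i,j} = 0` for `i > j`. -/
noncomputable def Scheck (N : ℕ) (i j : ℕ) : ℝ :=
  if i ≤ j then (stirlingSnd j i : ℝ) * (N.descFactorial i : ℝ) / (N : ℝ) ^ j else 0

theorem fp_card_coarser {m j : ℕ} (σ : Finpartition (Finset.univ : Finset (Fin m)))
    (hσ : σ.parts.card = j) (i : ℕ) :
    (Finset.univ.filter (fun π : Finpartition (Finset.univ : Finset (Fin m)) =>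
      π.parts.card = i ∧ σ ≤ π)).card = stirlingSnd j i := by
  obtain ⟨g, hg, hgσ⟩ : ∃ g : Fin m → Fin j, Function.Surjective g ∧
      ∀ x y, g x = g y ↔ σ.part x = σ.part y := by
    let e : σ.parts ≃ Fin j := Finset.equivFinOfCardEq hσ
    refine ⟨fun x => e ⟨σ.part x, σ.part_mem.2 (mem_univ x)⟩, ?_, ?_⟩
    · intro b
      obtain ⟨x, -, hx⟩ := σ.part_surjOn (e.symm b).2
      refine ⟨x, ?_⟩
      have h2 : (⟨σ.part x, σ.part_mem.2 (mem_univ x)⟩ : σ.parts) = e.symm b := Subtype.ext hx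
      exact (congrArg e h2).trans (e.apply_symm_apply b)
    · intro x y
      simp
  have hpre : Function.Injective
      (fun t : Finset (Fin j) => (Finset.univ.filter (fun x => g x ∈ t) : Finset (Fin m))) := by
    intro s t h
    ext b
    obtain ⟨x, rfl⟩ := hg b
    have := Finset.ext_iff.1 h x
    simpa using this
  let pull : Finpartition (Finset.univ : Finset (Fin j)) →
      Finpartition (Finset.univ : Finset (Fin m)) := fun τ =>
    Finpartition.ofExistsUnique
      (τ.parts.image (fun t => (Finset.univ.filter (fun x => g x ∈ t) : Finset (Fin m))))
      (fun p _ => subset_univ p)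
      (by
        intro a _
        refine ⟨Finset.univ.filter (fun x => g x ∈ τ.part (g a)), ⟨?_, ?_⟩, ?_⟩
        · exact mem_image_of_mem _ (τ.part_mem.2 (mem_univ _))
        · simp
        · rintro p ⟨hp, hap⟩
          obtain ⟨t, ht, rfl⟩ := mem_image.1 hp
          have : g a ∈ t := by simpa using hap
          rw [τ.part_eq_of_mem ht this])
      (by
        intro h
        obtain ⟨t, ht, h0⟩ := mem_image.1 h
        obtain ⟨b, hb⟩ := τ.nonempty_of_mem_parts ht
        obtain ⟨x, rfl⟩ := hg b
        have := Finset.ext_iff.1 h0 x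
        simp [hb] at this)
  have hpull : ∀ τ, (pull τ).parts =
      τ.parts.image (fun t => (Finset.univ.filter (fun x => g x ∈ t) : Finset (Fin m))) :=
    fun τ => rfl
  have hcard : ∀ τ, (pull τ).parts.card = τ.parts.card := fun τ => by
    rw [hpull, card_image_of_injective _ hpre]
  rw [stirlingSnd, Nat.card_eq_fintype_card, Fintype.card_subtype]
  symm
  refine Finset.card_bij (fun τ _ => pull τ) ?_ ?_ ?_
  · intro τ hτ
    have hτ' : τ.parts.card = i := by simpa using hτ
    refine mem_filter.2 ⟨mem_univ _, (hcard τ).trans hτ', ?_⟩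
    intro s hs
    obtain ⟨x, hx⟩ := σ.nonempty_of_mem_parts hs
    refine ⟨Finset.univ.filter (fun y => g y ∈ τ.part (g x)), ?_, ?_⟩
    · rw [hpull]
      exact mem_image_of_mem _ (τ.part_mem.2 (mem_univ _))
    · intro y hy
      have : g y = g x := by
        rw [hgσ, σ.part_eq_of_mem hs hx, σ.part_eq_of_mem hs hy]
      simp [this]
  · intro τ _ τ' _ h
    apply Finpartition.ext
    have h' := congrArg Finpartition.parts h
    simp only [hpull] at h'
    exact Finset.image_injective hpre h'
  · intro π hπ
    obtain ⟨-, hπi, hle⟩ := mem_filter.1 hπ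
    have hsat : ∀ p ∈ π.parts, ∀ x y, g x = g y → x ∈ p → y ∈ p := by
      intro p hp x y hxy hx
      obtain ⟨p', hp', hs⟩ := hle (σ.part_mem.2 (mem_univ x))
      have hx' : x ∈ p' := hs (σ.mem_part_self.2 (mem_univ x))
      have hy' : y ∈ p' := by
        apply hs
        rw [(hgσ x y).1 hxy]
        exact σ.mem_part_self.2 (mem_univ y)
      rwa [π.eq_of_mem_parts hp hp' hx hx']
    let τ : Finpartition (Finset.univ : Finset (Fin j)) :=
      Finpartition.ofExistsUnique (π.parts.image (fun p => p.image g))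
        (fun p _ => subset_univ p)
        (by
          intro b _
          obtain ⟨a, rfl⟩ := hg b
          refine ⟨(π.part a).image g, ⟨?_, ?_⟩, ?_⟩
          · exact mem_image_of_mem _ (π.part_mem.2 (mem_univ _))
          · exact mem_image_of_mem _ (π.mem_part_self.2 (mem_univ _))
          · rintro t ⟨ht, hat⟩
            obtain ⟨p, hp, rfl⟩ := mem_image.1 ht
            obtain ⟨x, hx, hxa⟩ := mem_image.1 hat
            rw [π.part_eq_of_mem hp (hsat p hp x a hxa hx)])
        (by
          intro h
          obtain ⟨p, hp, h0⟩ := mem_image.1 h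
          exact π.ne_empty hp (image_eq_empty.1 h0))
    have hτ : pull τ = π := by
      apply Finpartition.ext
      rw [hpull]
      change (π.parts.image (fun p => p.image g)).image _ = _
      rw [image_image]
      refine (image_congr (g := id) ?_).trans image_id
      intro p hp
      ext x
      simp only [Function.comp, mem_filter, mem_univ, true_and, mem_image, id]
      constructor
      · rintro ⟨y, hy, hyx⟩
        exact hsat p hp y x hyx hy
      · intro hx
        exact ⟨x, hx, rfl⟩
    refine ⟨τ, ?_, hτ⟩
    simp only [mem_filter, mem_univ, true_and]
    rw [← hcard, hτ, hπi]

/-- The action of the resampling matrix `S` on coefficient vectors induces the linear map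
`Š` on level-wise coefficient sums:  for every `f` and every `i ∈ {1, …, m}`,
`Σ_{#π = i} (S f)_π = Σ_{j=1}^m Š_{i,j} Σ_{#π = j} f_π`. -/
theorem resampS_levelwise (N m : ℕ) (hN : 1 ≤ N) (hm : 1 ≤ m)
    (f : Finpartition (Finset.univ : Finset (Fin m)) → ℝ) (i : ℕ) (hi : i ∈ Finset.Icc 1 m) :
    ∑ π ∈ Finset.univ.filter
        (fun π : Finpartition (Finset.univ : Finset (Fin m)) => π.parts.card = i),
        (resampS N m).mulVec f π
      = ∑ j ∈ Finset.Icc 1 m, Scheck N i j *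
          ∑ π ∈ Finset.univ.filter
            (fun π : Finpartition (Finset.univ : Finset (Fin m)) => π.parts.card = j), f π := by
  have key : ∀ σ : Finpartition (Finset.univ : Finset (Fin m)),
      ∑ π ∈ Finset.univ.filter
        (fun π : Finpartition (Finset.univ : Finset (Fin m)) => π.parts.card = i),
        resampS N m π σ = Scheck N i σ.parts.card := by
    intro σ
    have h1 : ∀ π ∈ Finset.univ.filter
        (fun π : Finpartition (Finset.univ : Finset (Fin m)) => π.parts.card = i),
        resampS N m π σ =
          if σ ≤ π then (N.descFactorial i : ℝ) / (N : ℝ) ^ σ.parts.card else 0 := by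
      intro π hπ
      rw [resampS, (mem_filter.1 hπ).2]
    rw [sum_congr rfl h1, ← sum_filter, filter_filter, sum_const, fp_card_coarser σ rfl i,
      nsmul_eq_mul, Scheck]
    split_ifs with h
    · ring
    · have h0 : stirlingSnd σ.parts.card i = 0 := by
        rw [← fp_card_coarser σ rfl i, card_eq_zero, filter_eq_empty_iff]
        rintro π - ⟨hπ, hle⟩
        exact h (hπ ▸ Finpartition.card_mono hle)
      simp [h0]
  have hmaps : ∀ σ ∈ (Finset.univ : Finset (Finpartition (Finset.univ : Finset (Fin m)))),
      σ.parts.card ∈ Finset.Icc 1 m := by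
    intro σ _
    refine mem_Icc.2 ⟨?_, ?_⟩
    · apply card_pos.2
      exact ⟨_, σ.part_mem.2 (mem_univ (⟨0, hm⟩ : Fin m))⟩
    · simpa using σ.card_parts_le_card
  simp only [Matrix.mulVec, dotProduct]
  rw [sum_comm]
  simp only [← sum_mul, key]
  rw [← sum_fiberwise_of_maps_to hmaps]
  refine sum_congr rfl fun j _ => ?_
  rw [mul_sum]
  refine sum_congr rfl fun σ hσ => ?_
  rw [(mem_filter.1 hσ).2]
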